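/- arXiv:1804.01358 — 2 statements merged into one kernel-verified Lean document; each statement's English description precedes it below -/
import Mathlib

section
/- Let A ∈ S_n and let {Q_k : k ∈ ℕ} be the iterates of the cyclic Jacobi (Jacobi CoM) algorithm applied to A. Suppose the set of accumulation points of {Q_k} is finite and has m elements with 1 < m < ∞. Let W^{(k)} denote the orthogonal transform of A by Q_k. Then the first-order directional derivatives along the chosen pairs tend to zero: d_{i_{k+1}, j_{k+1}}(W^{(k)}) → 0 as k → ∞. -/
open scoped BigOperators
open Matrix

/-- Orthogonal transform of a third-order tensor by a matrix `Q`: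
`W i j k = ∑ p q r, A p q r * Q p i * Q q j * Q r k`. -/
def transform (n : ℕ) (A : Fin n → Fin n → Fin n → ℝ) (Q : Matrix (Fin n) (Fin n) ℝ) :
    Fin n → Fin n → Fin n → ℝ :=
  fun i j k => ∑ p, ∑ q, ∑ r, A p q r * Q p i * Q q j * Q r k

/-- The objective `f(Q) = ∑ i, W i i i ^ 2`. -/
def fObj (n : ℕ) (A : Fin n → Fin n → Fin n → ℝ) (Q : Matrix (Fin n) (Fin n) ℝ) : ℝ :=
  ∑ i, (transform n A Q i i i) ^ 2

/-- A third-order tensor is symmetric if its entries are invariant under all permutations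
of the indices (transpositions of adjacent indices suffice). -/
def IsSymT (n : ℕ) (A : Fin n → Fin n → Fin n → ℝ) : Prop :=
  ∀ i j k : Fin n, A i j k = A j i k ∧ A i j k = A i k j

/-- The Givens rotation `G^{(i,j,θ)}`. -/
noncomputable def givens (n : ℕ) (i j : Fin n) (θ : ℝ) : Matrix (Fin n) (Fin n) ℝ :=
  Matrix.of fun k l =>
    if k = l then (if k = i ∨ k = j then Real.cos θ else 1)
    else if k = j ∧ l = i then Real.sin θ
    else if k = i ∧ l = j then -Real.sin θ
    else 0

/-- `d_{i,j}(A)`. -/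
def dT (n : ℕ) (A : Fin n → Fin n → Fin n → ℝ) (i j : Fin n) : ℝ :=
  A i i i * A i i j - A i j j * A j j j

/-- `ω_{i,j}(A)`. -/
def ωT (n : ℕ) (A : Fin n → Fin n → Fin n → ℝ) (i j : Fin n) : ℝ :=
  A i i i ^ 2 + A j j j ^ 2 - 3 * A i i j ^ 2 - 3 * A i j j ^ 2
    - 2 * A i i i * A i j j - 2 * A i i j * A j j j

/-- All pairs `(i, j)` with `i < j` listed in the cyclic-by-row order
`(1,2), (1,3), …, (1,n), (2,3), …, (n-1,n)`. -/
def pairList (n : ℕ) : List (Fin n × Fin n) :=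
  (List.finRange n).flatMap fun i =>
    (List.finRange n).filterMap fun j => if i < j then some (i, j) else none

/-- The sequence of pairs chosen by the cyclic-by-row rule: the pair used at step `k`
is the `(k mod N)`-th pair in the row order, where `N = n(n-1)/2`. -/
def CyclicPairs (n : ℕ) (pr : ℕ → Fin n × Fin n) : Prop :=
  ∀ k : ℕ, (pairList n)[k % (pairList n).length]? = some (pr k)

/-- `Q : ℕ → SO(n)` is the sequence of iterates of the cyclic Jacobi (Jacobi CoM)
algorithm applied to `A` with pair sequence `pr`: `Q 0 = I`, and
`Q (k+1) = Q k * G^{(i,j,θ)}` where `(i,j) = pr k` and `θ ∈ (−π/4, π/4]` is a global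
maximum point of `θ ↦ f(Q k * G^{(i,j,θ)})`. -/
def JacobiIterates (n : ℕ) (A : Fin n → Fin n → Fin n → ℝ)
    (pr : ℕ → Fin n × Fin n) (Q : ℕ → Matrix (Fin n) (Fin n) ℝ) : Prop :=
  Q 0 = 1 ∧
  ∀ k : ℕ, ∃ θ : ℝ, θ ∈ Set.Ioc (-(Real.pi / 4)) (Real.pi / 4) ∧
    (∀ θ' : ℝ, fObj n A (Q k * givens n (pr k).1 (pr k).2 θ') ≤
        fObj n A (Q k * givens n (pr k).1 (pr k).2 θ)) ∧
    Q (k + 1) = Q k * givens n (pr k).1 (pr k).2 θ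

lemma givens_col (n : ℕ) (Q : Matrix (Fin n) (Fin n) ℝ) (i j : Fin n) (hij : i ≠ j) (θ : ℝ)
    (p l : Fin n) :
    (Q * givens n i j θ) p l =
      if l = i then Real.cos θ * Q p i + Real.sin θ * Q p j
      else if l = j then -Real.sin θ * Q p i + Real.cos θ * Q p j else Q p l := by
  rw [Matrix.mul_apply]
  by_cases h1 : l = i
  · subst h1
    rw [← Finset.sum_subset (Finset.subset_univ {l, j}), Finset.sum_pair hij]
    · simp [givens, hij.symm]; ring
    · intro x _ hx
      simp at hx
      simp [givens, hx.1, hx.2]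
  · by_cases h2 : l = j
    · subst h2
      rw [← Finset.sum_subset (Finset.subset_univ {i, l}), Finset.sum_pair hij]
      · simp [givens, hij, hij.symm]; ring
      · intro x _ hx
        simp at hx
        simp [givens, hx.1, hx.2]
    · rw [Finset.sum_eq_single l]
      · simp [givens, h1, h2]
      · intro x _ hx
        simp [givens, h1, h2, hx]
      · simp

lemma sum_two (n : ℕ) (F F' : Fin n → ℝ) (i j : Fin n) (hij : i ≠ j)
    (h : ∀ l, l ≠ i → l ≠ j → F' l = F l) :
    ∑ l, F' l - ∑ l, F l = F' i + F' j - F i - F j := by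
  rw [← Finset.sum_sub_distrib, ← Finset.sum_subset (Finset.subset_univ {i, j}),
    Finset.sum_pair hij]
  · ring
  · intro x _ hx
    simp at hx
    rw [h x hx.1 hx.2, sub_self]

lemma row_inv (n : ℕ) (Q : Matrix (Fin n) (Fin n) ℝ) (i j : Fin n) (hij : i ≠ j) (θ : ℝ)
    (p : Fin n) : ∑ l, (Q * givens n i j θ) p l ^ 2 = ∑ l, Q p l ^ 2 := by
  have := sum_two n (fun l => Q p l ^ 2) (fun l => (Q * givens n i j θ) p l ^ 2) i j hij
    (by intro l h1 h2; simp only [givens_col n Q i j hij, h1, h2, if_false])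
  simp only [givens_col n Q i j hij θ p i, givens_col n Q i j hij θ p j, if_true, hij.symm,
    if_false] at this
  have hc := Real.sin_sq_add_cos_sq θ
  linear_combination this + (Q p i ^ 2 + Q p j ^ 2) * hc

lemma tr_symm (n : ℕ) (A : Fin n → Fin n → Fin n → ℝ) (hA : IsSymT n A)
    (Q : Matrix (Fin n) (Fin n) ℝ) : IsSymT n (transform n A Q) := by
  intro i j k
  constructor
  · unfold transform
    rw [Finset.sum_comm]
    refine Finset.sum_congr rfl fun p _ => Finset.sum_congr rfl fun q _ =>
      Finset.sum_congr rfl fun r _ => ?_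
    rw [(hA q p r).1]; ring
  · unfold transform
    refine Finset.sum_congr rfl fun p _ => ?_
    rw [Finset.sum_comm]
    refine Finset.sum_congr rfl fun q _ => Finset.sum_congr rfl fun r _ => ?_
    rw [(hA p q r).2]; ring

lemma tr_expand (n : ℕ) (A : Fin n → Fin n → Fin n → ℝ) (hA : IsSymT n A)
    (Q Q' : Matrix (Fin n) (Fin n) ℝ) (i j l : Fin n) (x y : ℝ)
    (h : ∀ p, Q' p l = x * Q p i + y * Q p j) :
    transform n A Q' l l l = x ^ 3 * transform n A Q i i i
      + 3 * x ^ 2 * y * transform n A Q i i j + 3 * x * y ^ 2 * transform n A Q i j j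
      + y ^ 3 * transform n A Q j j j := by
  have hS := tr_symm n A hA Q
  have e1 : transform n A Q i i j = transform n A Q i j i := (hS i i j).2
  have e2 : transform n A Q i j i = transform n A Q j i i := (hS i j i).1
  have e3 : transform n A Q i j j = transform n A Q j i j := (hS i j j).1
  have e4 : transform n A Q j i j = transform n A Q j j i := (hS j i j).2
  have key : transform n A Q' l l l = x ^ 3 * transform n A Q i i i
      + x ^ 2 * y * transform n A Q i i j + x ^ 2 * y * transform n A Q i j i
      + x ^ 2 * y * transform n A Q j i i + x * y ^ 2 * transform n A Q i j j
      + x * y ^ 2 * transform n A Q j i j + x * y ^ 2 * transform n A Q j j i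
      + y ^ 3 * transform n A Q j j j := by
    unfold transform
    simp only [Finset.mul_sum, ← Finset.sum_add_distrib]
    refine Finset.sum_congr rfl fun p _ => Finset.sum_congr rfl fun q _ =>
      Finset.sum_congr rfl fun r _ => ?_
    rw [h, h, h]; ring
  rw [key, ← e4, ← e3, ← e2, ← e1]; ring

lemma fObj_step (n : ℕ) (A : Fin n → Fin n → Fin n → ℝ) (hA : IsSymT n A)
    (Q : Matrix (Fin n) (Fin n) ℝ) (i j : Fin n) (hij : i ≠ j) (t : ℝ) :
    fObj n A (Q * givens n i j (Real.arctan t)) - fObj n A Q =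
      (Real.cos (Real.arctan t)) ^ 4 *
       (6 * dT n (transform n A Q) i j * t * (1 - t ^ 2) + t ^ 2 *
        (9 * transform n A Q i i j ^ 2 + 9 * transform n A Q i j j ^ 2
          + 6 * transform n A Q i i i * transform n A Q i j j
          + 6 * transform n A Q j j j * transform n A Q i i j
          - 3 * transform n A Q i i i ^ 2 - 3 * transform n A Q j j j ^ 2)) := by
  have hs : Real.sin (Real.arctan t) = t * Real.cos (Real.arctan t) := by
    rw [Real.sin_arctan, Real.cos_arctan]; ring
  have hc := Real.sin_sq_add_cos_sq (Real.arctan t)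
  have hG := givens_col n Q i j hij (Real.arctan t)
  set Q' := Q * givens n i j (Real.arctan t) with hQ'
  have h := sum_two n (fun l => transform n A Q l l l ^ 2)
    (fun l => transform n A Q' l l l ^ 2) i j hij
    (by
      intro l h1 h2
      simp only [transform, hG, h1, h2, if_false])
  simp only [fObj]
  rw [h]
  have ei := tr_expand n A hA Q Q' i j i _ _ (fun p => by rw [hG p i, if_pos rfl])
  have ej := tr_expand n A hA Q Q' i j j _ _
    (fun p => by rw [hG p j, if_neg hij.symm, if_pos rfl])
  simp only [ei, ej, dT]
  rw [hs] at *
  generalize Real.cos (Real.arctan t) = c at *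
  generalize transform n A Q i i i = a
  generalize transform n A Q i i j = b
  generalize transform n A Q i j j = e
  generalize transform n A Q j j j = g
  have hc' : c ^ 2 * (1 + t ^ 2) = 1 := by linarith
  have h6 : (c ^ 2 * (1 + t ^ 2)) ^ 3 = 1 := by rw [hc']; norm_num
  linear_combination (a ^ 2 + g ^ 2) * h6 + c ^ 4 * (6 * (a * b - e * g) * t * (1 - t ^ 2) + t ^ 2 *
    (9 * b ^ 2 + 9 * e ^ 2 + 6 * a * e + 6 * g * b - 3 * a ^ 2 - 3 * g ^ 2)) * hc'

lemma gain (n : ℕ) (A : Fin n → Fin n → Fin n → ℝ) (hA : IsSymT n A)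
    (Q : Matrix (Fin n) (Fin n) ℝ) (i j : Fin n) (hij : i ≠ j) (M : ℝ)
    (hM : ∀ i j k, |transform n A Q i j k| ≤ M) :
    ∃ θ, dT n (transform n A Q) i j ^ 2 ≤
      16 * (M ^ 2 + 1) * (fObj n A (Q * givens n i j θ) - fObj n A Q) := by
  set d := dT n (transform n A Q) i j with hd
  set ε : ℝ := 1 / (8 * (M ^ 2 + 1)) with hε
  have hεp : 0 < ε := by positivity
  have hεM : ε * (8 * (M ^ 2 + 1)) = 1 := by rw [hε]; field_simp
  refine ⟨Real.arctan (ε * d), ?_⟩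
  rw [fObj_step n A hA Q i j hij, ← hd]
  have ha := hM i i i
  have hb := hM i i j
  have he := hM i j j
  have hg := hM j j j
  have hd' : d = transform n A Q i i i * transform n A Q i i j
    - transform n A Q i j j * transform n A Q j j j := rfl
  have hc0 : Real.cos (Real.arctan (ε * d)) ^ 2 = 1 / (1 + (ε * d) ^ 2) :=
    Real.cos_sq_arctan _
  generalize transform n A Q i i i = a at *
  generalize transform n A Q i i j = b at *
  generalize transform n A Q i j j = e at *
  generalize transform n A Q j j j = g at *
  have ha2 := sq_le_sq' (abs_le.1 ha).1 (abs_le.1 ha).2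
  have hb2 := sq_le_sq' (abs_le.1 hb).1 (abs_le.1 hb).2
  have he2 := sq_le_sq' (abs_le.1 he).1 (abs_le.1 he).2
  have hg2 := sq_le_sq' (abs_le.1 hg).1 (abs_le.1 hg).2
  have hd1 : |d| ≤ 2 * M ^ 2 := by
    rw [abs_le]; constructor <;>
    nlinarith [sq_nonneg (a - b), sq_nonneg (a + b), sq_nonneg (e - g), sq_nonneg (e + g)]
  have ht1 : |ε * d| ≤ 1 / 4 := by
    rw [abs_mul, abs_of_pos hεp]
    have := mul_le_mul_of_nonneg_left hd1 hεp.le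
    nlinarith
  have ht2 : (ε * d) ^ 2 ≤ 1 / 16 := by
    have := sq_le_sq' (abs_le.1 ht1).1 (abs_le.1 ht1).2
    linarith
  have hc1 : 4 / 5 ≤ Real.cos (Real.arctan (ε * d)) ^ 2 := by
    rw [hc0, le_div_iff₀ (by positivity)]; linarith
  have hc4 : 1 / 2 ≤ Real.cos (Real.arctan (ε * d)) ^ 4 := by nlinarith
  have hV : -(8 * (M ^ 2 + 1)) ≤ 9 * b ^ 2 + 9 * e ^ 2 + 6 * a * e + 6 * g * b
      - 3 * a ^ 2 - 3 * g ^ 2 := by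
    nlinarith [sq_nonneg (a + 3 * e), sq_nonneg (g + 3 * b)]
  generalize 9 * b ^ 2 + 9 * e ^ 2 + 6 * a * e + 6 * g * b
      - 3 * a ^ 2 - 3 * g ^ 2 = V at *
  have hX : 2 * (ε * d ^ 2) ≤ 6 * d * (ε * d) * (1 - (ε * d) ^ 2) + (ε * d) ^ 2 * V := by
    have h1 : 0 ≤ ε * d ^ 2 := by positivity
    have h2 : (ε * d ^ 2) * (1 / 2) ≤ (ε * d ^ 2) * (1 - (ε * d) ^ 2) :=
      mul_le_mul_of_nonneg_left (by linarith) h1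
    have h3 := mul_le_mul_of_nonneg_left hV (sq_nonneg (ε * d))
    have h4 : (ε * d) ^ 2 * -(8 * (M ^ 2 + 1)) = - (ε * d ^ 2) := by
      linear_combination (-ε * d ^ 2) * hεM
    rw [h4] at h3
    nlinarith
  generalize 6 * d * (ε * d) * (1 - (ε * d) ^ 2) + (ε * d) ^ 2 * V = X at *
  have h1 : 0 ≤ ε * d ^ 2 := by positivity
  have h5 : ε * d ^ 2 ≤ Real.cos (Real.arctan (ε * d)) ^ 4 * X := by nlinarith
  have h6 := mul_le_mul_of_nonneg_left h5 (show 0 ≤ 8 * (M ^ 2 + 1) by positivity)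
  have h7 : 8 * (M ^ 2 + 1) * (ε * d ^ 2) = d ^ 2 := by linear_combination d ^ 2 * hεM
  nlinarith [sq_nonneg d]

lemma pr_ne (n : ℕ) (pr : ℕ → Fin n × Fin n) (hpr : CyclicPairs n pr) (k : ℕ) :
    (pr k).1 ≠ (pr k).2 := by
  have h := List.mem_of_getElem? (hpr k)
  simp only [pairList, List.mem_flatMap, List.mem_filterMap] at h
  obtain ⟨i, _, j, _, h⟩ := h
  split_ifs at h with hlt
  simp only [Option.some.injEq] at h
  rw [← h]; exact hlt.ne

/-- Proposition 6.4(iii) / `theorem-local-convergence-CoM`.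
Suppose the set of accumulation points of the cyclic Jacobi iterates `{Q_k}` is finite
with `m` elements, `1 < m < ∞`. Then the first-order directional derivatives along the
chosen pairs tend to zero: `d_{i_{k+1}, j_{k+1}}(W^{(k)}) → 0`, where
`W^{(k)} = A·(Q_k, Q_k, Q_k)`. -/
theorem stmt_18 (n : ℕ) (hn : 2 ≤ n) (A : Fin n → Fin n → Fin n → ℝ) (hA : IsSymT n A)
    (pr : ℕ → Fin n × Fin n) (hpr : CyclicPairs n pr)
    (Q : ℕ → Matrix (Fin n) (Fin n) ℝ) (hQ : JacobiIterates n A pr Q)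
    (m : ℕ) (hm : 1 < m)
    (hfin : {x : Matrix (Fin n) (Fin n) ℝ | MapClusterPt x Filter.atTop Q}.Finite)
    (hcard : {x : Matrix (Fin n) (Fin n) ℝ | MapClusterPt x Filter.atTop Q}.ncard = m) :
    Filter.Tendsto (fun k : ℕ => dT n (transform n A (Q k)) (pr k).1 (pr k).2)
      Filter.atTop (nhds 0) := by
  obtain ⟨hQ0, hstep⟩ := hQ
  have hne := pr_ne n pr hpr
  have hrow : ∀ k p, ∑ l, Q k p l ^ 2 = 1 := by
    intro k p
    induction k with
    | zero => simp [hQ0, Matrix.one_apply]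
    | succ k ih =>
      obtain ⟨θ, _, _, h⟩ := hstep k
      rw [h, row_inv n (Q k) _ _ (hne k), ih]
  have hent : ∀ k p l, |Q k p l| ≤ 1 := by
    intro k p l
    have := Finset.single_le_sum (f := fun l => Q k p l ^ 2) (fun l _ => sq_nonneg _)
      (Finset.mem_univ l)
    rw [hrow k p] at this
    exact (sq_le_one_iff_abs_le_one _).1 this
  set M : ℝ := ∑ p, ∑ q, ∑ r, |A p q r| with hMdef
  have hM : ∀ k i j l, |transform n A (Q k) i j l| ≤ M := by
    intro k i j l
    unfold transform
    refine (Finset.abs_sum_le_sum_abs _ _).trans (Finset.sum_le_sum fun p _ => ?_)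
    refine (Finset.abs_sum_le_sum_abs _ _).trans (Finset.sum_le_sum fun q _ => ?_)
    refine (Finset.abs_sum_le_sum_abs _ _).trans (Finset.sum_le_sum fun r _ => ?_)
    rw [abs_mul, abs_mul, abs_mul]
    have h0 := abs_nonneg (A p q r)
    refine (mul_le_of_le_one_right (by positivity) (hent k r l)).trans ?_
    refine (mul_le_of_le_one_right (by positivity) (hent k q j)).trans ?_
    exact mul_le_of_le_one_right (by positivity) (hent k p i)
  have hgain : ∀ k, dT n (transform n A (Q k)) (pr k).1 (pr k).2 ^ 2 ≤
      16 * (M ^ 2 + 1) * (fObj n A (Q (k + 1)) - fObj n A (Q k)) := by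
    intro k
    obtain ⟨θ, _, hmax, h⟩ := hstep k
    obtain ⟨θ', h'⟩ := gain n A hA (Q k) _ _ (hne k) M (hM k)
    refine h'.trans (mul_le_mul_of_nonneg_left ?_ (by positivity))
    rw [h]
    linarith [hmax θ']
  have hmono : Monotone fun k => fObj n A (Q k) := by
    refine monotone_nat_of_le_succ fun k => ?_
    have h1 := (sq_nonneg _).trans (hgain k)
    have h2 := nonneg_of_mul_nonneg_right h1 (by positivity)
    linarith
  have hbdd : BddAbove (Set.range fun k => fObj n A (Q k)) := by
    refine ⟨∑ _i : Fin n, M ^ 2, ?_⟩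
    rintro _ ⟨k, rfl⟩
    refine Finset.sum_le_sum fun i _ => ?_
    have h := abs_le.1 (hM k i i i)
    exact sq_le_sq' h.1 h.2
  have hlim := tendsto_atTop_ciSup hmono hbdd
  have hdiff : Filter.Tendsto (fun k => 16 * (M ^ 2 + 1) * (fObj n A (Q (k + 1)) - fObj n A (Q k)))
      Filter.atTop (nhds 0) := by
    have := (((Filter.tendsto_add_atTop_iff_nat 1).2 hlim).sub hlim).const_mul (16 * (M ^ 2 + 1))
    simpa using this
  have hsq := squeeze_zero (fun k => sq_nonneg _) hgain hdiff
  have habs := hsq.sqrt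
  simp only [Real.sqrt_sq_eq_abs, Real.sqrt_zero] at habs
  exact (tendsto_zero_iff_abs_tendsto_zero _).2 habs
end

section
/- Let A ∈ S_n and let {Q_k : k ∈ ℕ} be the iterates of the cyclic Jacobi (Jacobi CoM) algorithm applied to A. Let Q_* be an accumulation point of {Q_k} and let W^* be the orthogonal transform of A by Q_*. If ω_{i,j}(W^*) > 0 for all 1 ≤ i < j ≤ n, then either Q_k → Q_*, or the sequence {Q_k} has infinitely many accumulation points. -/
open scoped BigOperators
open Matrix

theorem aux_abs {X : Type*} [MetricSpace X] [ProperSpace X] (Q : ℕ → X) (x : X)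
    (hx : MapClusterPt x Filter.atTop Q)
    (hfin : {y | MapClusterPt y Filter.atTop Q}.Finite)
    (hstep : Filter.Tendsto (fun k => Q (k + 1)) (Filter.atTop ⊓ Filter.comap Q (nhds x)) (nhds x)) :
    Filter.Tendsto Q Filter.atTop (nhds x) := by
  have h1 : ({y | MapClusterPt y Filter.atTop Q} \ {x})ᶜ ∈ nhds x := by
    apply IsOpen.mem_nhds
    · exact (hfin.subset Set.diff_subset).isClosed.isOpen_compl
    · simp
  obtain ⟨r, hr, hrs⟩ := Metric.nhds_basis_closedBall.mem_iff.1 h1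
  have h2 : ∀ᶠ k in Filter.atTop ⊓ Filter.comap Q (nhds x), dist (Q (k + 1)) x < r :=
    hstep (Metric.ball_mem_nhds x hr)
  have h3 : ∃ δ > 0, ∀ᶠ k in Filter.atTop, dist (Q k) x < δ → dist (Q (k + 1)) x < r := by
    have := ((Filter.atTop_basis (α := ℕ)).inf (Metric.nhds_basis_ball.comap Q)).eventually_iff.1 h2
    obtain ⟨⟨K, δ⟩, ⟨-, hδ⟩, h⟩ := this
    refine ⟨δ, hδ, ?_⟩
    filter_upwards [Filter.eventually_ge_atTop K] with k hk hd
    exact h ⟨hk, hd⟩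
  obtain ⟨δ, hδ, h3⟩ := h3
  have h4 : ∀ η > 0, ∀ᶠ k in Filter.atTop, dist (Q k) x ≤ r → dist (Q k) x < η := by
    intro η hη
    by_contra hcon
    have hfr : ∃ᶠ k in Filter.atTop, Q k ∈ Metric.closedBall x r \ Metric.ball x η := by
      rw [Filter.not_eventually] at hcon
      refine hcon.mono ?_
      intro k hk
      push Not at hk
      exact ⟨hk.1, by simpa using hk.2⟩
    have hc : IsCompact (Metric.closedBall x r \ Metric.ball x η) :=
      (isCompact_closedBall x r).diff Metric.isOpen_ball
    obtain ⟨y, hy, hyc⟩ := hc.exists_mapClusterPt_of_frequently hfr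
    have := hrs hy.1
    simp only [Set.mem_compl_iff, Set.mem_diff, not_and, not_not] at this
    have hyx : y = x := this hyc
    apply hy.2
    rw [hyx]
    exact Metric.mem_ball_self hη
  rw [Metric.tendsto_nhds]
  intro ε hε
  have hη : 0 < min (min δ r) ε := by positivity
  obtain ⟨K, hK⟩ := Filter.eventually_atTop.1 (h3.and (h4 _ hη))
  have hf := hx.frequently (Metric.ball_mem_nhds x hη)
  obtain ⟨k0, hk0, hd0⟩ := Filter.frequently_atTop.1 hf K
  have key : ∀ k ≥ k0, dist (Q k) x < min (min δ r) ε := by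
    intro k hk
    induction k, hk using Nat.le_induction with
    | base => exact hd0
    | succ k hk ih =>
      have a1 := (hK k (hk0.trans hk)).1 (ih.trans_le ((min_le_left _ _).trans (min_le_left _ _)))
      exact (hK (k + 1) ((hk0.trans hk).trans (Nat.le_succ k))).2 a1.le
  filter_upwards [Filter.eventually_ge_atTop k0] with k hk
  exact (key k hk).trans_le (min_le_right _ _)

/-- trilinear form -/
def TF (n : ℕ) (A : Fin n → Fin n → Fin n → ℝ) (u v w : Fin n → ℝ) : ℝ :=
  ∑ p, ∑ q, ∑ r, A p q r * u p * v q * w r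

theorem TF_swap12 (n : ℕ) (A : Fin n → Fin n → Fin n → ℝ) (hA : IsSymT n A) (u v w : Fin n → ℝ) :
    TF n A u v w = TF n A v u w := by
  unfold TF
  rw [Finset.sum_comm]
  refine Finset.sum_congr rfl fun p _ => Finset.sum_congr rfl fun q _ =>
    Finset.sum_congr rfl fun r _ => ?_
  rw [(hA p q r).1]; ring

theorem TF_swap23 (n : ℕ) (A : Fin n → Fin n → Fin n → ℝ) (hA : IsSymT n A) (u v w : Fin n → ℝ) :
    TF n A u v w = TF n A u w v := by
  unfold TF
  refine Finset.sum_congr rfl fun p _ => ?_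
  rw [Finset.sum_comm]
  refine Finset.sum_congr rfl fun q _ =>
    Finset.sum_congr rfl fun r _ => ?_
  rw [(hA p q r).2]; ring

theorem TF_lin (n : ℕ) (A : Fin n → Fin n → Fin n → ℝ) (u u' v w : Fin n → ℝ) (c s : ℝ) :
    TF n A (fun p => c * u p + s * u' p) v w = c * TF n A u v w + s * TF n A u' v w := by
  unfold TF
  simp only [Finset.mul_sum, ← Finset.sum_add_distrib]
  refine Finset.sum_congr rfl fun p _ => Finset.sum_congr rfl fun q _ =>
    Finset.sum_congr rfl fun r _ => ?_
  ring

theorem TF_cube (n : ℕ) (A : Fin n → Fin n → Fin n → ℝ) (hA : IsSymT n A) (u v : Fin n → ℝ)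
    (c s : ℝ) :
    TF n A (fun p => c * u p + s * v p) (fun p => c * u p + s * v p) (fun p => c * u p + s * v p)
      = c ^ 3 * TF n A u u u + 3 * c ^ 2 * s * TF n A u u v + 3 * c * s ^ 2 * TF n A u v v
        + s ^ 3 * TF n A v v v := by
  have l2 : ∀ a b : Fin n → ℝ, TF n A a (fun p => c * u p + s * v p) b
      = c * TF n A a u b + s * TF n A a v b := by
    intro a b
    rw [TF_swap12 n A hA, TF_lin, TF_swap12 n A hA u, TF_swap12 n A hA v]
  have l3 : ∀ a b : Fin n → ℝ, TF n A a b (fun p => c * u p + s * v p)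
      = c * TF n A a b u + s * TF n A a b v := by
    intro a b
    rw [TF_swap23 n A hA, l2, TF_swap23 n A hA a u, TF_swap23 n A hA a v]
  rw [TF_lin, l2, l2, l3, l3, l3, l3]
  have e1 : TF n A u v u = TF n A u u v := TF_swap23 n A hA _ _ _
  have e2 : TF n A v u u = TF n A u u v := by rw [TF_swap12 n A hA, e1]
  have e3 : TF n A v u v = TF n A u v v := TF_swap12 n A hA _ _ _
  have e4 : TF n A v v u = TF n A u v v := by rw [TF_swap23 n A hA, e3]
  rw [e1, e2, e3, e4]; ring

theorem givens_col_i (n : ℕ) (Q : Matrix (Fin n) (Fin n) ℝ) (i j : Fin n) (hij : i < j) (θ : ℝ)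
    (p : Fin n) : (Q * givens n i j θ) p i = Real.cos θ * Q p i + Real.sin θ * Q p j := by
  have hne := hij.ne
  rw [Matrix.mul_apply, Finset.sum_eq_add i j hne]
  · simp [givens, hne, hne.symm]; ring
  · rintro c - ⟨h1, h2⟩; simp [givens, h1, h2]
  · simp
  · simp

theorem givens_col_j (n : ℕ) (Q : Matrix (Fin n) (Fin n) ℝ) (i j : Fin n) (hij : i < j) (θ : ℝ)
    (p : Fin n) : (Q * givens n i j θ) p j = Real.cos θ * Q p j + (-Real.sin θ) * Q p i := by
  have hne := hij.ne
  rw [Matrix.mul_apply, Finset.sum_eq_add i j hne]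
  · simp [givens, hne, hne.symm]; ring
  · rintro c - ⟨h1, h2⟩; simp [givens, h1, h2]
  · simp
  · simp

theorem givens_col_l (n : ℕ) (Q : Matrix (Fin n) (Fin n) ℝ) (i j l : Fin n) (hi : l ≠ i)
    (hj : l ≠ j) (θ : ℝ) (p : Fin n) : (Q * givens n i j θ) p l = Q p l := by
  rw [Matrix.mul_apply, Finset.sum_eq_single l]
  · simp [givens, hi, hj]
  · intro c _ hc; simp [givens, hc, hi, hj]
  · simp

theorem fObj_diff (n : ℕ) (A : Fin n → Fin n → Fin n → ℝ) (hA : IsSymT n A)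
    (Q : Matrix (Fin n) (Fin n) ℝ) (i j : Fin n) (hij : i < j) (θ : ℝ) :
    fObj n A (Q * givens n i j θ) - fObj n A Q =
      (3 / 8 * ωT n (transform n A Q) i j) * (Real.cos (4 * θ) - 1)
        + (3 / 2 * dT n (transform n A Q) i j) * Real.sin (4 * θ) := by
  have hne := hij.ne
  have hT : ∀ (Q : Matrix (Fin n) (Fin n) ℝ) a b c, transform n A Q a b c =
      TF n A (fun p => Q p a) (fun p => Q p b) (fun p => Q p c) := fun _ _ _ _ => rfl
  unfold fObj
  rw [← Finset.sum_sub_distrib, Finset.sum_eq_add i j hne]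
  · unfold ωT dT
    simp only [hT, givens_col_i n Q i j hij, givens_col_j n Q i j hij]
    rw [TF_cube n A hA, TF_cube n A hA]
    have e1 : TF n A (fun p => Q p j) (fun p => Q p j) (fun p => Q p i)
      = TF n A (fun p => Q p i) (fun p => Q p j) (fun p => Q p j) := by
      rw [TF_swap23 n A hA, TF_swap12 n A hA]
    have e2 : TF n A (fun p => Q p j) (fun p => Q p i) (fun p => Q p i)
      = TF n A (fun p => Q p i) (fun p => Q p i) (fun p => Q p j) := by
      rw [TF_swap12 n A hA, TF_swap23 n A hA]
    rw [e1, e2]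
    have h4 : 4 * θ = 2 * (2 * θ) := by ring
    have hs : Real.sin (4 * θ) = 4 * Real.sin θ * Real.cos θ * (Real.cos θ ^ 2 - Real.sin θ ^ 2) := by
      rw [h4, Real.sin_two_mul, Real.sin_two_mul, Real.cos_two_mul']; ring
    have hc : Real.cos (4 * θ) = 1 - 8 * Real.sin θ ^ 2 * Real.cos θ ^ 2 := by
      rw [h4, Real.cos_two_mul, Real.cos_sq', Real.sin_two_mul]; ring
    rw [hs, hc]
    have hsc : Real.sin θ ^ 2 = 1 - Real.cos θ ^ 2 := Real.sin_sq θ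
    generalize TF n A (fun p => Q p i) (fun p => Q p i) (fun p => Q p i) = a
    generalize TF n A (fun p => Q p i) (fun p => Q p i) (fun p => Q p j) = b
    generalize TF n A (fun p => Q p i) (fun p => Q p j) (fun p => Q p j) = e
    generalize TF n A (fun p => Q p j) (fun p => Q p j) (fun p => Q p j) = d
    generalize Real.sin θ = s at *
    generalize Real.cos θ = c at *
    have p3 : s ^ 3 = s * (1 - c ^ 2) := by rw [← hsc]; ring
    have p4 : s ^ 4 = (1 - c ^ 2) ^ 2 := by rw [← hsc]; ring
    have p5 : s ^ 5 = s * (1 - c ^ 2) ^ 2 := by rw [← hsc]; ring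
    have p6 : s ^ 6 = (1 - c ^ 2) ^ 3 := by rw [← hsc]; ring
    ring_nf
    rw [p3, p4, p5, p6, hsc]
    ring
  · rintro l - ⟨h1, h2⟩
    simp only [hT, givens_col_l n Q i j l h1 h2, sub_self]
  · simp
  · simp

theorem trig_max (α β x M : ℝ) (hM : M = α * Real.cos x + β * Real.sin x)
    (h : ∀ φ, α * Real.cos φ + β * Real.sin φ ≤ M) :
    α * (1 - Real.cos x) ≤ M - α := by
  have hd : HasDerivAt (fun φ => α * Real.cos φ + β * Real.sin φ)
      (α * (-Real.sin x) + β * Real.cos x) x :=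
    ((Real.hasDerivAt_cos x).const_mul α).add ((Real.hasDerivAt_sin x).const_mul β)
  have h0 := IsLocalMax.hasDerivAt_eq_zero
    (Filter.Eventually.of_forall (fun φ => by simpa [← hM] using h φ)) hd
  have hα : α = M * Real.cos x := by
    rw [hM]
    linear_combination (-Real.sin x) * h0 - α * Real.sin_sq_add_cos_sq x
  have hMn : 0 ≤ M := by
    have := h (x + Real.pi)
    rw [Real.cos_add_pi, Real.sin_add_pi] at this
    linarith
  have := mul_nonneg hMn (sq_nonneg (1 - Real.cos x))
  rw [hα]; nlinarith

theorem step_bound (n : ℕ) (A : Fin n → Fin n → Fin n → ℝ) (hA : IsSymT n A)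
    (Q : Matrix (Fin n) (Fin n) ℝ) (i j : Fin n) (hij : i < j) (θ : ℝ)
    (hθ : θ ∈ Set.Ioc (-(Real.pi / 4)) (Real.pi / 4))
    (hmax : ∀ θ' : ℝ, fObj n A (Q * givens n i j θ') ≤ fObj n A (Q * givens n i j θ))
    (δ : ℝ) (hδ : 0 < δ) (hω : δ ≤ ωT n (transform n A Q) i j) :
    Real.sin θ ^ 2 ≤ (fObj n A (Q * givens n i j θ) - fObj n A Q) / δ := by
  have hfd := fObj_diff n A hA Q i j hij
  set w := ωT n (transform n A Q) i j
  set D := dT n (transform n A Q) i j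
  have h1 := trig_max (3 / 8 * w) (3 / 2 * D) (4 * θ) _ rfl (by
    intro φ
    have a := hmax (φ / 4)
    have b := hfd (φ / 4)
    have c := hfd θ
    have : 4 * (φ / 4) = φ := by ring
    rw [this] at b
    linarith)
  have h2 := hfd θ
  have hcos : 1 / 2 ≤ Real.cos θ ^ 2 := by
    have : 0 ≤ Real.cos (2 * θ) := Real.cos_nonneg_of_mem_Icc
      ⟨by linarith [hθ.1], by linarith [hθ.2]⟩
    rw [Real.cos_two_mul] at this
    linarith
  have hc : Real.cos (4 * θ) = 1 - 8 * Real.sin θ ^ 2 * Real.cos θ ^ 2 := by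
    rw [show 4 * θ = 2 * (2 * θ) by ring, Real.cos_two_mul, Real.cos_sq', Real.sin_two_mul]; ring
  have h3 : 4 * Real.sin θ ^ 2 ≤ 1 - Real.cos (4 * θ) := by
    rw [hc]; nlinarith [sq_nonneg (Real.sin θ)]
  have h4 : δ * (4 * Real.sin θ ^ 2) ≤ w * (1 - Real.cos (4 * θ)) :=
    mul_le_mul hω h3 (by positivity) (hδ.le.trans hω)
  rw [le_div_iff₀ hδ]
  nlinarith [mul_nonneg hδ.le (sq_nonneg (Real.sin θ))]

theorem givens_near (n : ℕ) (i j : Fin n) (θ : ℝ)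
    (hθ : θ ∈ Set.Ioc (-(Real.pi / 4)) (Real.pi / 4)) (p q : Fin n) :
    |givens n i j θ p q - (1 : Matrix (Fin n) (Fin n) ℝ) p q| ≤ |Real.sin θ| := by
  have hc0 : 0 ≤ Real.cos θ := Real.cos_nonneg_of_mem_Icc
    ⟨by linarith [hθ.1, Real.pi_pos], by linarith [hθ.2, Real.pi_pos]⟩
  have hc : |Real.cos θ - 1| ≤ |Real.sin θ| := by
    have h1 := Real.cos_le_one θ
    rw [abs_sub_comm, abs_of_nonneg (by linarith)]
    have h2 := Real.abs_sin_le_one θ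
    have h3 := Real.sin_sq_add_cos_sq θ
    rw [← sq_abs] at h3
    nlinarith [abs_nonneg (Real.sin θ)]
  unfold givens
  simp only [Matrix.of_apply, Matrix.one_apply]
  split_ifs <;> simp [hc]

theorem pr_lt (n : ℕ) (pr : ℕ → Fin n × Fin n) (hpr : CyclicPairs n pr) (k : ℕ) :
    (pr k).1 < (pr k).2 := by
  have := List.mem_of_getElem? (hpr k)
  unfold pairList at this
  simp only [List.mem_flatMap, List.mem_filterMap, List.mem_finRange, true_and] at this
  obtain ⟨i, j, h⟩ := this
  split_ifs at h with hlt
  rw [Option.some.injEq] at h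
  rw [← h]; exact hlt

theorem continuous_transform (n : ℕ) (A : Fin n → Fin n → Fin n → ℝ) (i j k : Fin n) :
    Continuous fun Q : Matrix (Fin n) (Fin n) ℝ => transform n A Q i j k := by
  unfold transform
  have : ∀ p q : Fin n, Continuous fun Q : Matrix (Fin n) (Fin n) ℝ => Q p q :=
    fun p q => continuous_id.matrix_elem p q
  fun_prop

theorem continuous_fObj (n : ℕ) (A : Fin n → Fin n → Fin n → ℝ) :
    Continuous (fObj n A) := by
  unfold fObj
  have := fun i => continuous_transform n A i i i
  fun_prop

theorem continuous_omega (n : ℕ) (A : Fin n → Fin n → Fin n → ℝ) (i j : Fin n) :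
    Continuous fun Q : Matrix (Fin n) (Fin n) ℝ => ωT n (transform n A Q) i j := by
  unfold ωT
  have := continuous_transform n A
  have h1 := this i i i
  have h2 := this i i j
  have h3 := this i j j
  have h4 := this j j j
  fun_prop

theorem givens_zero (n : ℕ) (i j : Fin n) : givens n i j 0 = 1 := by
  ext p q
  simp [givens, Matrix.one_apply]

theorem step_tendsto (n : ℕ) (A : Fin n → Fin n → Fin n → ℝ) (hA : IsSymT n A)
    (pr : ℕ → Fin n × Fin n) (hpr : CyclicPairs n pr)
    (Q : ℕ → Matrix (Fin n) (Fin n) ℝ) (hQ : JacobiIterates n A pr Q)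
    (Qstar : Matrix (Fin n) (Fin n) ℝ) (hacc : MapClusterPt Qstar Filter.atTop Q)
    (hω : ∀ i j : Fin n, i < j → 0 < ωT n (transform n A Qstar) i j) :
    Filter.Tendsto (fun k => Q (k + 1)) (Filter.atTop ⊓ Filter.comap Q (nhds Qstar))
      (nhds Qstar) := by
  obtain ⟨-, hQ⟩ := hQ
  choose θ hθ hmax hstep using hQ
  have hmono : Monotone fun k => fObj n A (Q k) := by
    apply monotone_nat_of_le_succ
    intro k
    have := hmax k 0
    rw [givens_zero, mul_one, ← hstep] at this
    exact this
  have hcl : MapClusterPt (fObj n A Qstar) Filter.atTop fun k => fObj n A (Q k) :=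
    hacc.continuousAt_comp (continuous_fObj n A).continuousAt
  have hlim : Filter.Tendsto (fun k => fObj n A (Q k)) Filter.atTop (nhds (fObj n A Qstar)) := by
    rcases tendsto_of_monotone hmono with h | ⟨l, h⟩
    · exfalso
      have e := h.eventually_gt_atTop (fObj n A Qstar + 1)
      have f := hcl.frequently (Iio_mem_nhds (show fObj n A Qstar < fObj n A Qstar + 1 by linarith))
      obtain ⟨k, h1, h2⟩ := (f.and_eventually e).exists
      exact absurd h1 (not_lt.2 h2.le)
    · have : fObj n A Qstar = l := by
        have h' : ClusterPt (fObj n A Qstar) (nhds l) := hcl.clusterPt.mono h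
        exact eq_of_nhds_neBot h'
      rw [this]; exact h
  have hdiff : Filter.Tendsto (fun k => fObj n A (Q (k + 1)) - fObj n A (Q k)) Filter.atTop
      (nhds 0) := by
    have := (hlim.comp (Filter.tendsto_add_atTop_nat 1)).sub hlim
    rw [sub_self] at this
    exact this
  set F := Filter.atTop ⊓ Filter.comap Q (nhds Qstar)
  have hQF : Filter.Tendsto Q F (nhds Qstar) := Filter.tendsto_comap.mono_left inf_le_right
  obtain ⟨δ, hδ, hev⟩ : ∃ δ > 0, ∀ᶠ k in F, ∀ i j : Fin n, i < j →
      δ ≤ ωT n (transform n A (Q k)) i j := by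
    have : ∀ i j : Fin n, ∃ δ > 0, i < j → δ < ωT n (transform n A Qstar) i j := by
      intro i j
      by_cases h : i < j
      · exact ⟨_, half_pos (hω i j h), fun _ => half_lt_self (hω i j h)⟩
      · exact ⟨1, one_pos, fun h' => absurd h' h⟩
    choose d hd hd' using this
    obtain ⟨δ, hδ, hle⟩ : ∃ δ > 0, ∀ p : Fin n × Fin n, δ ≤ d p.1 p.2 := by
      rcases isEmpty_or_nonempty (Fin n × Fin n) with h | h
      · exact ⟨1, one_pos, fun p => h.elim p⟩
      · obtain ⟨p, hp⟩ := Finite.exists_min fun p : Fin n × Fin n => d p.1 p.2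
        exact ⟨_, hd p.1 p.2, hp⟩
    refine ⟨δ, hδ, ?_⟩
    rw [Filter.eventually_all]; intro i
    rw [Filter.eventually_all]; intro j
    by_cases h : i < j
    · have := Filter.Tendsto.eventually_const_lt ((hle (i, j)).trans_lt (hd' i j h))
        ((continuous_omega n A i j).continuousAt.tendsto.comp hQF)
      filter_upwards [this] with k hk _ using hk.le
    · exact Filter.Eventually.of_forall fun _ h' => absurd h' h
  have hs2 : Filter.Tendsto (fun k => Real.sin (θ k) ^ 2) F (nhds 0) := by
    have h0 := (hdiff.mono_left (inf_le_left : F ≤ _)).div_const δ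
    rw [zero_div] at h0
    refine tendsto_of_tendsto_of_tendsto_of_le_of_le' tendsto_const_nhds h0
      (Filter.Eventually.of_forall fun k => sq_nonneg _) ?_
    filter_upwards [hev] with k hk
    have hlt := pr_lt n pr hpr k
    rw [hstep k]
    exact step_bound n A hA (Q k) _ _ hlt (θ k) (hθ k) (hmax k) δ hδ (hk _ _ hlt)
  have hs : Filter.Tendsto (fun k => |Real.sin (θ k)|) F (nhds 0) := by
    have := (Real.continuous_sqrt.tendsto 0).comp hs2
    rw [Real.sqrt_zero] at this
    refine this.congr fun k => ?_
    exact Real.sqrt_sq_eq_abs _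
  have hG : Filter.Tendsto (fun k => givens n (pr k).1 (pr k).2 (θ k)) F (nhds 1) := by
    refine tendsto_pi_nhds.2 fun p => tendsto_pi_nhds.2 fun q => ?_
    rw [tendsto_iff_dist_tendsto_zero]
    refine squeeze_zero (fun _ => dist_nonneg) (fun k => ?_) hs
    exact givens_near n _ _ _ (hθ k) p q
  have := hQF.mul hG
  rw [mul_one] at this
  exact this.congr fun k => (hstep k).symm

/-- Corollary 6.5 / `corollary-convergence-stationary`.
Let `Q_*` be an accumulation point of the cyclic Jacobi iterates `{Q_k}` and let
`W^* = A·(Q_*,Q_*,Q_*)`. If `ω_{i,j}(W^*) > 0` for all `i < j`, then either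
`Q_k → Q_*`, or `{Q_k}` has infinitely many accumulation points. -/
theorem stmt_19 (n : ℕ) (hn : 2 ≤ n) (A : Fin n → Fin n → Fin n → ℝ) (hA : IsSymT n A)
    (pr : ℕ → Fin n × Fin n) (hpr : CyclicPairs n pr)
    (Q : ℕ → Matrix (Fin n) (Fin n) ℝ) (hQ : JacobiIterates n A pr Q)
    (Qstar : Matrix (Fin n) (Fin n) ℝ) (hacc : MapClusterPt Qstar Filter.atTop Q)
    (hω : ∀ i j : Fin n, i < j → 0 < ωT n (transform n A Qstar) i j) :
    Filter.Tendsto Q Filter.atTop (nhds Qstar) ∨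
      {x : Matrix (Fin n) (Fin n) ℝ | MapClusterPt x Filter.atTop Q}.Infinite := by
  by_cases hfin : {x : Matrix (Fin n) (Fin n) ℝ | MapClusterPt x Filter.atTop Q}.Finite
  · left
    exact aux_abs (X := Fin n → Fin n → ℝ) Q Qstar hacc hfin
      (step_tendsto n A hA pr hpr Q hQ Qstar hacc hω)
  · right
    exact hfin
end
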